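/- Let R be a commutative noetherian ring, 𝔭 a prime ideal of R, and M, N finitely generated R-modules. If the localizations M_𝔭 and N_𝔭 are isomorphic as R_𝔭-modules, then there exists f ∈ R with f ∉ 𝔭 such that the localizations M_f and N_f are isomorphic as R_f-modules. -/

import Mathlib

theorem delocalization_of_iso {R : Type*} [CommRing R] [IsNoetherianRing R]
    (p : Ideal R) [p.IsPrime]
    (M N : Type*) [AddCommGroup M] [Module R M] [AddCommGroup N] [Module R N]
    [Module.Finite R M] [Module.Finite R N]
    (h : Nonempty ((LocalizedModule p.primeCompl M) ≃ₗ[Localization p.primeCompl]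
        (LocalizedModule p.primeCompl N))) :
    ∃ f : R, f ∉ p ∧ Nonempty ((LocalizedModule (Submonoid.powers f) M)
        ≃ₗ[Localization (Submonoid.powers f)]
          (LocalizedModule (Submonoid.powers f) N)) := by
  obtain ⟨e⟩ := h
  have := Module.finitePresentation_of_finite R M
  have := Module.finitePresentation_of_finite R N
  obtain ⟨f, hf, e', -⟩ := Module.FinitePresentation.exists_lift_equiv_of_isLocalizedModule
    p.primeCompl (LocalizedModule.mkLinearMap p.primeCompl M)
    (LocalizedModule.mkLinearMap p.primeCompl N) (e.restrictScalars R)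
  exact ⟨f, hf, ⟨e'⟩⟩
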